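/- arXiv:2003.04798 — 9 statements merged into one kernel-verified Lean document; each statement's English description precedes it below -/
import Mathlib

section
/- Let γ > 0 and let h : ℝ → ℝ be the Cauchy penalty function h(x) = log((γ² + x²)/γ). Then for every x ∈ ℝ, the second derivative of h at x is at least −1/(4γ²); equivalently, the function x ↦ h(x) + x²/(8γ²) is convex on ℝ. -/
theorem hasDerivAt_log_sq_add_sq_div {γ : ℝ} (hγ : 0 < γ) (x : ℝ) :
    HasDerivAt (fun x : ℝ => Real.log ((γ ^ 2 + x ^ 2) / γ)) (2 * x / (γ ^ 2 + x ^ 2)) x := by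
  have hpos : 0 < γ ^ 2 + x ^ 2 := by positivity
  have hquad : HasDerivAt (fun x : ℝ => (γ ^ 2 + x ^ 2) / γ) (2 * x / γ) x := by
    simpa using ((hasDerivAt_pow 2 x).const_add (γ ^ 2)).div_const γ
  refine (hquad.log (by positivity)).congr_deriv ?_
  field_simp

theorem hasDerivAt_two_mul_div_sq_add_sq {γ : ℝ} (hγ : 0 < γ) (x : ℝ) :
    HasDerivAt (fun x : ℝ => 2 * x / (γ ^ 2 + x ^ 2))
      (2 * (γ ^ 2 - x ^ 2) / (γ ^ 2 + x ^ 2) ^ 2) x := by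
  have hpos : 0 < γ ^ 2 + x ^ 2 := by positivity
  refine (((hasDerivAt_id' x).const_mul 2).fun_div
    ((hasDerivAt_pow 2 x).const_add (γ ^ 2)) hpos.ne').congr_deriv ?_
  push_cast
  ring

theorem neg_one_div_le_sq_sub_sq_div {γ : ℝ} (hγ : 0 < γ) (x : ℝ) :
    -(1 / (4 * γ ^ 2)) ≤ 2 * (γ ^ 2 - x ^ 2) / (γ ^ 2 + x ^ 2) ^ 2 := by
  have hpos : 0 < γ ^ 2 + x ^ 2 := by positivity
  rw [← neg_div, div_le_div_iff₀ (by positivity) (by positivity)]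
  nlinarith [sq_nonneg (3 * γ ^ 2 - x ^ 2)]

theorem cauchy_penalty_weakly_convex (γ : ℝ) (hγ : 0 < γ) :
    (∀ x : ℝ,
      -(1 / (4 * γ ^ 2)) ≤ deriv (deriv (fun x : ℝ => Real.log ((γ ^ 2 + x ^ 2) / γ))) x) ∧
    ConvexOn ℝ Set.univ
      (fun x : ℝ => Real.log ((γ ^ 2 + x ^ 2) / γ) + x ^ 2 / (8 * γ ^ 2)) := by
  constructor
  · intro x
    rw [funext fun y => (hasDerivAt_log_sq_add_sq_div hγ y).deriv,
      (hasDerivAt_two_mul_div_sq_add_sq hγ x).deriv]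
    exact neg_one_div_le_sq_sub_sq_div hγ x
  · have hderiv (x : ℝ) := (hasDerivAt_log_sq_add_sq_div hγ x).fun_add
      ((hasDerivAt_pow 2 x).div_const (8 * γ ^ 2))
    have hderiv2 (x : ℝ) : HasDerivAt
        (fun x : ℝ => 2 * x / (γ ^ 2 + x ^ 2) + (2 : ℕ) * x ^ (2 - 1) / (8 * γ ^ 2))
        (2 * (γ ^ 2 - x ^ 2) / (γ ^ 2 + x ^ 2) ^ 2 + 1 / (4 * γ ^ 2)) x := by
      refine ((hasDerivAt_two_mul_div_sq_add_sq hγ x).fun_add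
        (((hasDerivAt_pow (2 - 1) x).const_mul ((2 : ℕ) : ℝ)).div_const (8 * γ ^ 2))).congr_deriv ?_
      norm_num
      ring
    refine convexOn_of_hasDerivWithinAt2_nonneg convex_univ
      (fun x _ => (hderiv x).continuousAt.continuousWithinAt)
      (fun x _ => (hderiv x).hasDerivWithinAt) (fun x _ => (hderiv2 x).hasDerivWithinAt)
      fun x _ => ?_
    linarith [neg_one_div_le_sq_sub_sq_div hγ x]
end

section
/- Let r > 0, σ > 0 and γ > 0 satisfy γ ≥ σ/(2√r). Then for every x ∈ ℝ, r/σ² + (2γ² − 2x²)/(x² + γ²)² ≥ 0. -/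
theorem hessian_entry_nonneg (r σ γ : ℝ) (hr : 0 < r) (hσ : 0 < σ) (hγ : 0 < γ)
    (hcond : σ / (2 * Real.sqrt r) ≤ γ) (x : ℝ) :
    0 ≤ r / σ ^ 2 + (2 * γ ^ 2 - 2 * x ^ 2) / (x ^ 2 + γ ^ 2) ^ 2 := by
  have hσ_le : σ ≤ γ * (2 * Real.sqrt r) := (div_le_iff₀ (by positivity)).mp hcond
  have hσ_sq : σ ^ 2 ≤ r * (4 * γ ^ 2) := by
    calc σ ^ 2 ≤ (γ * (2 * Real.sqrt r)) ^ 2 := by gcongr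
      _ = r * (4 * γ ^ 2) := by
        rw [mul_pow, mul_pow, Real.sq_sqrt hr.le]
        ring
  have hr_div : 1 / (4 * γ ^ 2) ≤ r / σ ^ 2 := by
    rw [div_le_div_iff₀ (by positivity) (by positivity)]
    linarith
  have h_square : 1 / (4 * γ ^ 2) + (2 * γ ^ 2 - 2 * x ^ 2) / (x ^ 2 + γ ^ 2) ^ 2
      = (x ^ 2 - 3 * γ ^ 2) ^ 2 / (4 * γ ^ 2 * (x ^ 2 + γ ^ 2) ^ 2) := by
    have : x ^ 2 + γ ^ 2 ≠ 0 := by positivity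
    field_simp
    ring
  calc 0 ≤ (x ^ 2 - 3 * γ ^ 2) ^ 2 / (4 * γ ^ 2 * (x ^ 2 + γ ^ 2) ^ 2) := by positivity
    _ = 1 / (4 * γ ^ 2) + (2 * γ ^ 2 - 2 * x ^ 2) / (x ^ 2 + γ ^ 2) ^ 2 := h_square.symm
    _ ≤ r / σ ^ 2 + (2 * γ ^ 2 - 2 * x ^ 2) / (x ^ 2 + γ ^ 2) ^ 2 := by gcongr
end

section
/- Let μ > 0 and γ > 0 satisfy γ ≥ √μ/2. Then for every u ∈ ℝ, 1/μ + (2γ² − 2u²)/(u² + γ²)² ≥ 0. -/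
theorem prox_second_deriv_nonneg (μ γ : ℝ) (hμ : 0 < μ) (hγ : 0 < γ)
    (hcond : Real.sqrt μ / 2 ≤ γ) (u : ℝ) :
    0 ≤ 1 / μ + (2 * γ ^ 2 - 2 * u ^ 2) / (u ^ 2 + γ ^ 2) ^ 2 := by
  have hμγ : μ ≤ 4 * γ ^ 2 := by
    have h : μ ≤ (2 * γ) ^ 2 := (Real.sqrt_le_left (by positivity)).mp (by linarith)
    linarith
  have hnum : 0 ≤ (u ^ 2 + γ ^ 2) ^ 2 + μ * (2 * γ ^ 2 - 2 * u ^ 2) := by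
    rcases le_total (u ^ 2) (γ ^ 2) with h | h
    · have : 0 ≤ μ * (2 * γ ^ 2 - 2 * u ^ 2) := mul_nonneg hμ.le (by linarith)
      positivity
    · nlinarith [sq_nonneg (u ^ 2 - 3 * γ ^ 2),
        mul_nonneg (sub_nonneg.mpr hμγ) (sub_nonneg.mpr h)]
  have hden : (u ^ 2 + γ ^ 2) ^ 2 ≠ 0 := by positivity
  rw [div_add_div _ _ hμ.ne' hden, one_mul]
  positivity
end

section
/- Let m, n be natural numbers, A : ℝⁿ → ℝᵐ a continuous linear map between the Euclidean spaces ℝⁿ and ℝᵐ, r > 0 a real number with ‖A x‖² = r · ‖x‖² for all x ∈ ℝⁿ (i.e. AᵀA = r·I), let y ∈ ℝᵐ, σ > 0, and γ ≥ σ/(2√r). Then the cost function F : ℝⁿ → ℝ defined by F(x) = ‖y − A x‖²/(2σ²) + Σᵢ log((γ² + xᵢ²)/γ) is strictly convex on ℝⁿ. -/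
/-- The one-dimensional cost `c t² / 2 + log ((γ² + t²) / γ)` is strictly convex as soon as the
quadratic weight `c` dominates the most negative curvature `-1 / (4 γ²)` of the Cauchy penalty. -/
theorem strictConvexOn_sq_add_cauchy_penalty {c γ : ℝ} (hγ : 0 < γ) (hc : 1 ≤ 4 * γ ^ 2 * c) :
    StrictConvexOn ℝ Set.univ
      (fun t : ℝ => c / 2 * t ^ 2 + Real.log ((γ ^ 2 + t ^ 2) / γ)) := by
  have hderiv : ∀ t : ℝ, HasDerivAt
      (fun t : ℝ => c / 2 * t ^ 2 + Real.log ((γ ^ 2 + t ^ 2) / γ))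
      (c * t + 2 * t / (γ ^ 2 + t ^ 2)) t := by
    intro t
    have hpos : 0 < γ ^ 2 + t ^ 2 := by positivity
    have hsq : HasDerivAt (fun t : ℝ => t ^ 2) (2 * t) t := by
      simpa using hasDerivAt_pow 2 t
    refine ((hsq.const_mul (c / 2)).add
      (((hsq.const_add (γ ^ 2)).div_const γ).log (div_pos hpos hγ).ne')).congr_deriv ?_
    field_simp
  refine StrictMono.strictConvexOn_univ_of_deriv
    (continuous_iff_continuousAt.2 fun t => (hderiv t).continuousAt) ?_
  intro s t hst
  rw [(hderiv s).deriv, (hderiv t).deriv, ← sub_pos]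
  have hs : 0 < γ ^ 2 + s ^ 2 := by positivity
  have ht : 0 < γ ^ 2 + t ^ 2 := by positivity
  have hfactor : c * t + 2 * t / (γ ^ 2 + t ^ 2) - (c * s + 2 * s / (γ ^ 2 + s ^ 2)) =
      (t - s) * (4 * γ ^ 2 * c * ((γ ^ 2 + s ^ 2) * (γ ^ 2 + t ^ 2))
        - 8 * γ ^ 2 * (s * t - γ ^ 2)) /
        (4 * γ ^ 2 * ((γ ^ 2 + s ^ 2) * (γ ^ 2 + t ^ 2))) := by
    field_simp
    ring
  have hcurv : 8 * γ ^ 2 * (s * t - γ ^ 2) < (γ ^ 2 + s ^ 2) * (γ ^ 2 + t ^ 2) := by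
    have hgap : 0 < γ ^ 2 * (t - s) ^ 2 := by
      have := sub_pos.2 hst
      positivity
    linarith [sq_nonneg (s * t - 3 * γ ^ 2),
      show (γ ^ 2 + s ^ 2) * (γ ^ 2 + t ^ 2) - 8 * γ ^ 2 * (s * t - γ ^ 2) =
        (s * t - 3 * γ ^ 2) ^ 2 + γ ^ 2 * (t - s) ^ 2 by ring]
  have hweight := le_mul_of_one_le_left (mul_pos hs ht).le hc
  rw [hfactor]
  exact div_pos (mul_pos (sub_pos.2 hst) (by linarith)) (by positivity)

/-- A separable sum of a strictly convex function of each coordinate is strictly convex. -/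
theorem StrictConvexOn.sum_euclidean {ι : Type*} [Fintype ι] {g : ℝ → ℝ}
    (hg : StrictConvexOn ℝ Set.univ g) :
    StrictConvexOn ℝ Set.univ (fun x : EuclideanSpace ℝ ι => ∑ i, g (x i)) := by
  refine ⟨convex_univ, fun x _ z _ hxz a b ha hb hab => ?_⟩
  obtain ⟨j, hj⟩ : ∃ j, x j ≠ z j := by
    by_contra! h
    exact hxz (PiLp.ext h)
  simp only [Finset.smul_sum, ← Finset.sum_add_distrib]
  refine Finset.sum_lt_sum (fun i _ => ?_) ⟨j, Finset.mem_univ j, ?_⟩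
  · exact hg.convexOn.2 (Set.mem_univ _) (Set.mem_univ _) ha.le hb.le hab
  · exact hg.2 (Set.mem_univ _) (Set.mem_univ _) hj ha hb hab

theorem cauchy_cost_strictConvex (m n : ℕ)
    (A : EuclideanSpace ℝ (Fin n) →L[ℝ] EuclideanSpace ℝ (Fin m))
    (r : ℝ) (hr : 0 < r) (hA : ∀ x, ‖A x‖ ^ 2 = r * ‖x‖ ^ 2)
    (y : EuclideanSpace ℝ (Fin m)) (σ : ℝ) (hσ : 0 < σ)
    (γ : ℝ) (hγ : σ / (2 * Real.sqrt r) ≤ γ) :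
    StrictConvexOn ℝ Set.univ
      (fun x : EuclideanSpace ℝ (Fin n) =>
        ‖y - A x‖ ^ 2 / (2 * σ ^ 2) + ∑ i, Real.log ((γ ^ 2 + (x i) ^ 2) / γ)) := by
  have hsqrt : 0 < Real.sqrt r := Real.sqrt_pos.2 hr
  have hγ_pos : 0 < γ := lt_of_lt_of_le (by positivity) hγ
  have hc : 1 ≤ 4 * γ ^ 2 * (r / σ ^ 2) := by
    rw [div_le_iff₀ (by positivity)] at hγ
    have hsq := pow_le_pow_left₀ hσ.le hγ 2
    rw [mul_pow, mul_pow, Real.sq_sqrt hr.le] at hsq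
    rw [mul_div_assoc', le_div_iff₀ (by positivity)]
    linarith
  have hlin : ConvexOn ℝ Set.univ (fun x : EuclideanSpace ℝ (Fin n) =>
      (-(σ ^ 2)⁻¹ • ((innerSL ℝ y).comp A).toLinearMap) x) :=
    LinearMap.convexOn _ convex_univ
  have hsum := ((strictConvexOn_sq_add_cauchy_penalty hγ_pos hc).sum_euclidean
    (ι := Fin n)).add_convexOn (hlin.add_const (‖y‖ ^ 2 / (2 * σ ^ 2)))
  refine hsum.congr fun x _ => ?_
  have hnorm := hA x
  rw [EuclideanSpace.real_norm_sq_eq x] at hnorm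
  simp only [Pi.add_apply, Finset.sum_add_distrib, ← Finset.mul_sum, LinearMap.smul_apply,
    ContinuousLinearMap.coe_coe, ContinuousLinearMap.comp_apply, innerSL_apply_apply, smul_eq_mul]
  rw [norm_sub_sq_real, hnorm]
  field_simp
  ring
end

section
/- Let m, n be natural numbers, A : ℝⁿ → ℝᵐ a continuous linear map between the Euclidean spaces ℝⁿ and ℝᵐ, r > 0 with ‖A x‖² = r · ‖x‖² for all x ∈ ℝⁿ, let y ∈ ℝᵐ, σ > 0, and γ ≥ σ/(2√r). Then the cost function F : ℝⁿ → ℝ defined by F(x) = ‖y − A x‖²/(2σ²) + Σᵢ log((γ² + xᵢ²)/γ) attains a global minimum at exactly one point of ℝⁿ, i.e. there exists a unique x* ∈ ℝⁿ with F(x*) ≤ F(x) for all x ∈ ℝⁿ. -/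
theorem continuous_sq_sub_add_log_cauchy {γ : ℝ} (hγ : 0 < γ) (a c : ℝ) :
    Continuous fun t : ℝ => a * t ^ 2 - c * t + Real.log ((γ ^ 2 + t ^ 2) / γ) := by
  refine Continuous.add (by fun_prop) (Continuous.log (by fun_prop) fun t => ?_)
  positivity

theorem hasDerivAt_sq_sub_add_log_cauchy {γ : ℝ} (hγ : 0 < γ) (a c t : ℝ) :
    HasDerivAt (fun t : ℝ => a * t ^ 2 - c * t + Real.log ((γ ^ 2 + t ^ 2) / γ))
      (2 * a * t - c + 2 * t / (γ ^ 2 + t ^ 2)) t := by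
  have hpos : (γ ^ 2 + t ^ 2) / γ ≠ 0 := by positivity
  have hsum : γ ^ 2 + t ^ 2 ≠ 0 := by positivity
  have hsq : HasDerivAt (fun t : ℝ => t ^ 2) (2 * t) t := by simpa using hasDerivAt_pow 2 t
  have hlog := ((hsq.const_add (γ ^ 2)).div_const γ).log hpos
  refine (((hsq.const_mul a).sub ((hasDerivAt_id t).const_mul c)).add hlog).congr_deriv ?_
  field_simp

theorem strictConvexOn_sq_sub_add_log_cauchy {γ a : ℝ} (hγ : 0 < γ) (c : ℝ)
    (ha : 1 / (8 * γ ^ 2) ≤ a) :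
    StrictConvexOn ℝ Set.univ
      fun t : ℝ => a * t ^ 2 - c * t + Real.log ((γ ^ 2 + t ^ 2) / γ) := by
  refine StrictMono.strictConvexOn_univ_of_deriv (continuous_sq_sub_add_log_cauchy hγ a c) ?_
  intro s t hst
  rw [(hasDerivAt_sq_sub_add_log_cauchy hγ a c s).deriv,
    (hasDerivAt_sq_sub_add_log_cauchy hγ a c t).deriv]
  have hst' : 0 < t - s := sub_pos.2 hst
  have hs : 0 < γ ^ 2 + s ^ 2 := by positivity
  have ht : 0 < γ ^ 2 + t ^ 2 := by positivity
  have hkey : 0 < (t - s) * (γ ^ 2 * (t - s) ^ 2 + (s * t - 3 * γ ^ 2) ^ 2) /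
      (4 * γ ^ 2 * (γ ^ 2 + s ^ 2) * (γ ^ 2 + t ^ 2)) := by positivity
  have heq : (2 * (1 / (8 * γ ^ 2)) * t + 2 * t / (γ ^ 2 + t ^ 2)) -
      (2 * (1 / (8 * γ ^ 2)) * s + 2 * s / (γ ^ 2 + s ^ 2)) =
      (t - s) * (γ ^ 2 * (t - s) ^ 2 + (s * t - 3 * γ ^ 2) ^ 2) /
        (4 * γ ^ 2 * (γ ^ 2 + s ^ 2) * (γ ^ 2 + t ^ 2)) := by
    field_simp
    ring
  have hmul := mul_le_mul_of_nonneg_right ha hst'.le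
  linarith

open Filter in
theorem tendsto_sq_sub_add_log_cauchy {γ a : ℝ} (hγ : 0 < γ) (ha : 0 < a) (c : ℝ) :
    Tendsto (fun t : ℝ => a * t ^ 2 - c * t + Real.log ((γ ^ 2 + t ^ 2) / γ))
      (cocompact ℝ) atTop := by
  refine tendsto_atTop_mono (fun t => ?_) (tendsto_atTop_add_const_right _
    (Real.log γ - (|c| + 1) ^ 2 / (4 * a)) (tendsto_norm_cocompact_atTop (E := ℝ)))
  have hlog : Real.log γ ≤ Real.log ((γ ^ 2 + t ^ 2) / γ) := by
    refine Real.log_le_log hγ ?_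
    rw [le_div_iff₀ hγ]
    nlinarith [sq_nonneg t]
  have hlin : c * t ≤ |c| * |t| := (le_abs_self _).trans (abs_mul c t).le
  have hsq : a * t ^ 2 - (|c| + 1) * |t| + (|c| + 1) ^ 2 / (4 * a) =
      (2 * a * |t| - (|c| + 1)) ^ 2 / (4 * a) := by
    rw [← sq_abs t]
    field_simp
    ring
  have hnonneg : 0 ≤ (2 * a * |t| - (|c| + 1)) ^ 2 / (4 * a) := by positivity
  rw [Real.norm_eq_abs]
  linarith

theorem existsUnique_forall_sq_sub_add_log_cauchy_le {γ a : ℝ} (hγ : 0 < γ) (c : ℝ)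
    (ha : 1 / (8 * γ ^ 2) ≤ a) :
    ∃! s : ℝ, ∀ t : ℝ, a * s ^ 2 - c * s + Real.log ((γ ^ 2 + s ^ 2) / γ) ≤
      a * t ^ 2 - c * t + Real.log ((γ ^ 2 + t ^ 2) / γ) := by
  have ha0 : 0 < a := lt_of_lt_of_le (by positivity) ha
  obtain ⟨s, hs⟩ := (continuous_sq_sub_add_log_cauchy hγ a c).exists_forall_le
    (tendsto_sq_sub_add_log_cauchy hγ ha0 c)
  refine ⟨s, hs, fun u hu => ?_⟩
  exact (strictConvexOn_sq_sub_add_log_cauchy hγ c ha).eq_of_isMinOn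
    (fun t _ => hu t) (fun t _ => hs t) (Set.mem_univ _) (Set.mem_univ _)

/-- A separable function whose coordinate functions have unique minimisers has a unique
minimiser. -/
theorem existsUnique_forall_sum_le {ι : Type*} [Fintype ι] (g : ι → ℝ → ℝ)
    (hg : ∀ i, ∃! s, ∀ t, g i s ≤ g i t) :
    ∃! x : EuclideanSpace ℝ ι, ∀ z : EuclideanSpace ℝ ι, ∑ i, g i (x i) ≤ ∑ i, g i (z i) := by
  choose s hs huniq using hg
  refine ⟨WithLp.toLp 2 s, fun z => Finset.sum_le_sum fun i _ => hs i (z i), fun x hx => ?_⟩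
  have hle : ∀ i ∈ Finset.univ, g i (s i) ≤ g i (x i) := fun i _ => hs i (x i)
  have heq := (Finset.sum_eq_sum_iff_of_le hle).1
    (le_antisymm (Finset.sum_le_sum hle) (hx (WithLp.toLp 2 s)))
  ext i
  exact huniq i (x i) fun t => (heq i (Finset.mem_univ i)).symm.trans_le (hs i t)

theorem cauchy_cost_unique_min (m n : ℕ)
    (A : EuclideanSpace ℝ (Fin n) →L[ℝ] EuclideanSpace ℝ (Fin m))
    (r : ℝ) (hr : 0 < r) (hA : ∀ x, ‖A x‖ ^ 2 = r * ‖x‖ ^ 2)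
    (y : EuclideanSpace ℝ (Fin m)) (σ : ℝ) (hσ : 0 < σ)
    (γ : ℝ) (hγ : σ / (2 * Real.sqrt r) ≤ γ) :
    ∃! xstar : EuclideanSpace ℝ (Fin n),
      ∀ x : EuclideanSpace ℝ (Fin n),
        ‖y - A xstar‖ ^ 2 / (2 * σ ^ 2) + ∑ i, Real.log ((γ ^ 2 + (xstar i) ^ 2) / γ) ≤
        ‖y - A x‖ ^ 2 / (2 * σ ^ 2) + ∑ i, Real.log ((γ ^ 2 + (x i) ^ 2) / γ) := by
  have hsqrt : 0 < Real.sqrt r := Real.sqrt_pos.2 hr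
  have hγ0 : 0 < γ := lt_of_lt_of_le (by positivity) hγ
  have ha : 1 / (8 * γ ^ 2) ≤ r / (2 * σ ^ 2) := by
    rw [div_le_iff₀ (by positivity)] at hγ
    have hsq := pow_le_pow_left₀ hσ.le hγ 2
    rw [mul_pow, mul_pow, Real.sq_sqrt hr.le] at hsq
    rw [div_le_div_iff₀ (by positivity) (by positivity)]
    linarith
  set b := ContinuousLinearMap.adjoint A y with hb
  have hcost : ∀ x : EuclideanSpace ℝ (Fin n),
      ‖y - A x‖ ^ 2 / (2 * σ ^ 2) + ∑ i, Real.log ((γ ^ 2 + (x i) ^ 2) / γ) =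
      ‖y‖ ^ 2 / (2 * σ ^ 2) + ∑ i, (r / (2 * σ ^ 2) * (x i) ^ 2 - b i / σ ^ 2 * x i +
        Real.log ((γ ^ 2 + (x i) ^ 2) / γ)) := by
    intro x
    have hinner : inner ℝ y (A x) = ∑ i, b i * x i := by
      rw [← ContinuousLinearMap.adjoint_inner_left, ← hb, PiLp.inner_apply]
      simp [mul_comm]
    have hlin : ∑ i, b i / σ ^ 2 * x i = (∑ i, b i * x i) / σ ^ 2 := by
      rw [Finset.sum_div]
      exact Finset.sum_congr rfl fun i _ => by ring
    rw [norm_sub_sq_real, hA, hinner, EuclideanSpace.real_norm_sq_eq x, Finset.sum_add_distrib,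
      Finset.sum_sub_distrib, ← Finset.mul_sum, hlin]
    field_simp
    ring
  simp only [hcost, add_le_add_iff_left]
  exact existsUnique_forall_sum_le
    (fun i t => r / (2 * σ ^ 2) * t ^ 2 - b i / σ ^ 2 * t + Real.log ((γ ^ 2 + t ^ 2) / γ))
    fun i => existsUnique_forall_sq_sub_add_log_cauchy_le hγ0 _ ha
end

section
/- Let μ > 0, γ > 0 with γ ≥ √μ/2, and let x ∈ ℝ. Then the function J : ℝ → ℝ defined by J(u) = (x − u)²/(2μ) + log((γ² + u²)/γ) is strictly convex on ℝ. -/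
theorem hasDerivAt_cauchy_prox_cost {μ γ : ℝ} (hμ : μ ≠ 0) (hγ : 0 < γ) (x u : ℝ) :
    HasDerivAt (fun u : ℝ => (x - u) ^ 2 / (2 * μ) + Real.log ((γ ^ 2 + u ^ 2) / γ))
      ((u - x) / μ + 2 * u / (γ ^ 2 + u ^ 2)) u := by
  have hpos : 0 < γ ^ 2 + u ^ 2 := by positivity
  have hquad := (((hasDerivAt_id u).const_sub x).pow 2).div_const (2 * μ)
  have hlog := ((((hasDerivAt_id u).pow 2).const_add (γ ^ 2)).div_const γ).log
    (div_pos hpos hγ).ne'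
  refine (hquad.add hlog).congr_deriv ?_
  simp only [id, Pi.pow_apply]
  field_simp
  push_cast
  ring

theorem strictMono_deriv_cauchy_prox_cost {μ γ : ℝ} (hμ : 0 < μ) (hγ : 0 < γ)
    (h : μ ≤ 4 * γ ^ 2) (x : ℝ) :
    StrictMono (fun u : ℝ => (u - x) / μ + 2 * u / (γ ^ 2 + u ^ 2)) := by
  intro a b hab
  have ha : 0 < γ ^ 2 + a ^ 2 := by positivity
  have hb : 0 < γ ^ 2 + b ^ 2 := by positivity
  have hd : 0 < b - a := sub_pos.2 hab
  have key : 0 < (γ ^ 2 + a ^ 2) * (γ ^ 2 + b ^ 2) + 2 * μ * (γ ^ 2 - a * b) := by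
    rcases le_total (a * b) (γ ^ 2) with hle | hle
    · have := mul_nonneg hμ.le (sub_nonneg.2 hle)
      nlinarith [mul_pos ha hb]
    · have hsq : 0 < γ ^ 2 * (b - a) ^ 2 := by positivity
      nlinarith [mul_le_mul_of_nonneg_right h (sub_nonneg.2 hle),
        sq_nonneg (a * b - 3 * γ ^ 2)]
  rw [← sub_pos]
  have hdiff : (b - x) / μ + 2 * b / (γ ^ 2 + b ^ 2) - ((a - x) / μ + 2 * a / (γ ^ 2 + a ^ 2)) =
      (b - a) * ((γ ^ 2 + a ^ 2) * (γ ^ 2 + b ^ 2) + 2 * μ * (γ ^ 2 - a * b)) /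
        (μ * (γ ^ 2 + a ^ 2) * (γ ^ 2 + b ^ 2)) := by
    field_simp
    ring
  simp only [hdiff]
  positivity

theorem cauchy_prox_cost_strictConvex (μ γ : ℝ) (hμ : 0 < μ) (hγ : 0 < γ)
    (hcond : Real.sqrt μ / 2 ≤ γ) (x : ℝ) :
    StrictConvexOn ℝ Set.univ
      (fun u : ℝ => (x - u) ^ 2 / (2 * μ) + Real.log ((γ ^ 2 + u ^ 2) / γ)) := by
  have hμγ : μ ≤ 4 * γ ^ 2 := by
    nlinarith [Real.sq_sqrt hμ.le, Real.sqrt_nonneg μ]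
  have hderiv := hasDerivAt_cauchy_prox_cost hμ.ne' hγ x
  refine StrictMono.strictConvexOn_univ_of_deriv
    (continuous_iff_continuousAt.2 fun u => (hderiv u).continuousAt) ?_
  rw [funext fun u => (hderiv u).deriv]
  exact strictMono_deriv_cauchy_prox_cost hμ hγ hμγ x
end

section
/- Let μ > 0, γ > 0 with γ ≥ √μ/2, and let x ∈ ℝ. Then the cubic equation u³ − x·u² + (γ² + 2μ)·u − x·γ² = 0 has exactly one real solution u. -/
theorem cauchy_prox_cubic_unique_root (μ γ : ℝ) (hμ : 0 < μ) (hγ : 0 < γ)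
    (hcond : Real.sqrt μ / 2 ≤ γ) (x : ℝ) :
    ∃! u : ℝ, u ^ 3 - x * u ^ 2 + (γ ^ 2 + 2 * μ) * u - x * γ ^ 2 = 0 := by
  have hμγ : μ ≤ 4 * γ ^ 2 := by
    nlinarith [Real.sq_sqrt hμ.le, Real.sqrt_nonneg μ]
  refine existsUnique_of_exists_of_unique ?_ ?_
  · have hcont : Continuous
        fun u : ℝ ↦ u ^ 3 - x * u ^ 2 + (γ ^ 2 + 2 * μ) * u - x * γ ^ 2 := by
      fun_prop
    have hmem := intermediate_value_uIcc (hcont.continuousOn (s := Set.uIcc 0 x))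
    obtain ⟨u, -, hu⟩ := hmem (show (0 : ℝ) ∈ _ by
      rw [Set.mem_uIcc]
      have hγ2 : 0 < γ ^ 2 := by positivity
      rcases le_total 0 x with hx | hx
      · left
        constructor <;> nlinarith
      · right
        constructor <;> nlinarith)
    exact ⟨u, hu⟩
  · intro u v hu hv
    by_contra hne
    have hfactor : (u - v) *
        ((γ ^ 2 + u * v) ^ 2 + γ ^ 2 * (u - v) ^ 2 + 2 * μ * (γ ^ 2 - u * v)) = 0 := by
      linear_combination (γ ^ 2 + v ^ 2) * hu - (γ ^ 2 + u ^ 2) * hv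
    have hsep : 0 < γ ^ 2 * (u - v) ^ 2 := by
      have := sub_ne_zero.mpr hne
      positivity
    have hrest : 0 ≤ (γ ^ 2 + u * v) ^ 2 + 2 * μ * (γ ^ 2 - u * v) := by
      rcases le_total (u * v) (γ ^ 2) with h | h
      · have := mul_nonneg hμ.le (sub_nonneg.mpr h)
        nlinarith [sq_nonneg (γ ^ 2 + u * v)]
      · nlinarith [mul_nonneg (sub_nonneg.mpr hμγ) (sub_nonneg.mpr h),
          sq_nonneg (u * v - 3 * γ ^ 2)]
    rcases mul_eq_zero.mp hfactor with h | h
    · exact hne (sub_eq_zero.mp h)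
    · linarith
end

section
/- Let n be a natural number, μ > 0, γ > 0 with γ ≥ √μ/2, and c ∈ ℝⁿ (Euclidean space). Then the function G : ℝⁿ → ℝ defined by G(u) = ‖c − u‖²/(2μ) + Σᵢ log((γ² + uᵢ²)/γ) is strictly convex on ℝⁿ. -/
lemma strictMono_deriv_quadratic_add_log {μ γ : ℝ} (hμ : 0 < μ) (hγ : 0 < γ)
    (h : μ ≤ 4 * γ ^ 2) (a : ℝ) :
    StrictMono (fun t : ℝ => (t - a) / μ + 2 * t / (γ ^ 2 + t ^ 2)) := by
  intro s t hst
  have hs : 0 < γ ^ 2 + s ^ 2 := by positivity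
  have ht : 0 < γ ^ 2 + t ^ 2 := by positivity
  have hd : 0 < t - s := sub_pos.2 hst
  have key : 0 < (γ ^ 2 + s ^ 2) * (γ ^ 2 + t ^ 2) + 2 * μ * (γ ^ 2 - s * t) := by
    rcases le_total (s * t) (γ ^ 2) with hle | hle
    · have := mul_nonneg hμ.le (sub_nonneg.2 hle)
      have := mul_pos hs ht
      linarith
    · have h₁ := mul_le_mul_of_nonneg_right h (sub_nonneg.2 hle)
      have h₂ : 0 < γ ^ 2 * (t - s) ^ 2 := by positivity
      nlinarith [sq_nonneg (s * t - 3 * γ ^ 2)]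
  have hdiff : (t - a) / μ + 2 * t / (γ ^ 2 + t ^ 2) - ((s - a) / μ + 2 * s / (γ ^ 2 + s ^ 2)) =
      (t - s) * ((γ ^ 2 + s ^ 2) * (γ ^ 2 + t ^ 2) + 2 * μ * (γ ^ 2 - s * t)) /
        (μ * (γ ^ 2 + s ^ 2) * (γ ^ 2 + t ^ 2)) := by
    field_simp
    ring
  refine sub_pos.1 ?_
  rw [hdiff]
  positivity

lemma strictConvexOn_quadratic_add_log {μ γ : ℝ} (hμ : 0 < μ) (hγ : 0 < γ)
    (h : μ ≤ 4 * γ ^ 2) (a : ℝ) :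
    StrictConvexOn ℝ Set.univ
      (fun t : ℝ => (a - t) ^ 2 / (2 * μ) + Real.log ((γ ^ 2 + t ^ 2) / γ)) := by
  have hderiv (t : ℝ) :
      HasDerivAt (fun t : ℝ => (a - t) ^ 2 / (2 * μ) + Real.log ((γ ^ 2 + t ^ 2) / γ))
        ((t - a) / μ + 2 * t / (γ ^ 2 + t ^ 2)) t := by
    have ht : 0 < γ ^ 2 + t ^ 2 := by positivity
    have h₁ := (((hasDerivAt_id t).const_sub a).pow 2).div_const (2 * μ)
    have h₂ := ((((hasDerivAt_id t).pow 2).const_add (γ ^ 2)).div_const γ).log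
      (div_pos ht hγ).ne'
    refine (h₁.add h₂).congr_deriv ?_
    simp only [id, Pi.pow_apply]
    field_simp
    ring
  refine StrictMono.strictConvexOn_univ_of_deriv
    (continuous_iff_continuousAt.2 fun t => (hderiv t).continuousAt) ?_
  rw [funext fun t => (hderiv t).deriv]
  exact strictMono_deriv_quadratic_add_log hμ hγ h a

lemma EuclideanSpace.strictConvexOn_sum {ι : Type*} [Fintype ι] {f : ι → ℝ → ℝ}
    (hf : ∀ i, StrictConvexOn ℝ Set.univ (f i)) :
    StrictConvexOn ℝ Set.univ (fun u : EuclideanSpace ℝ ι => ∑ i, f i (u i)) := by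
  refine ⟨convex_univ, fun x _ y _ hxy a b ha hb hab => ?_⟩
  obtain ⟨j, hj⟩ : ∃ j, x j ≠ y j := by
    by_contra! hne
    exact hxy (PiLp.ext hne)
  simp only [smul_eq_mul, Finset.mul_sum, ← Finset.sum_add_distrib]
  refine Finset.sum_lt_sum (fun i _ => ?_) ⟨j, Finset.mem_univ j, ?_⟩
  · simpa using (hf i).convexOn.2 (Set.mem_univ (x i)) (Set.mem_univ (y i)) ha.le hb.le hab
  · simpa using (hf j).2 (Set.mem_univ (x j)) (Set.mem_univ (y j)) hj ha hb hab

theorem cauchy_fb_subproblem_strictConvex (n : ℕ) (μ γ : ℝ) (hμ : 0 < μ) (hγ : 0 < γ)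
    (hcond : Real.sqrt μ / 2 ≤ γ) (c : EuclideanSpace ℝ (Fin n)) :
    StrictConvexOn ℝ Set.univ
      (fun u : EuclideanSpace ℝ (Fin n) =>
        ‖c - u‖ ^ 2 / (2 * μ) + ∑ i, Real.log ((γ ^ 2 + (u i) ^ 2) / γ)) := by
  have h : μ ≤ 4 * γ ^ 2 := by
    have := Real.sq_sqrt hμ.le
    nlinarith [Real.sqrt_nonneg μ]
  have hsum := EuclideanSpace.strictConvexOn_sum
    fun i => strictConvexOn_quadratic_add_log hμ hγ h (c i)
  convert hsum using 2 with u
  rw [EuclideanSpace.real_norm_sq_eq, Finset.sum_div, ← Finset.sum_add_distrib]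
  simp
end

section
/- Let n be a natural number, μ > 0, γ > 0 with γ ≥ √μ/2, and c ∈ ℝⁿ (Euclidean space). Then the function G : ℝⁿ → ℝ defined by G(u) = ‖c − u‖²/(2μ) + Σᵢ log((γ² + uᵢ²)/γ) attains a global minimum at exactly one point of ℝⁿ, i.e. there exists a unique u* ∈ ℝⁿ with G(u*) ≤ G(u) for all u ∈ ℝⁿ. -/
open Filter Set

theorem hasDerivAt_cauchyCost {μ γ : ℝ} (hμ : 0 < μ) (hγ : 0 < γ) (a x : ℝ) :
    HasDerivAt (fun x : ℝ => (a - x) ^ 2 / (2 * μ) + Real.log ((γ ^ 2 + x ^ 2) / γ))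
      ((x - a) / μ + 2 * x / (γ ^ 2 + x ^ 2)) x := by
  have hpos : 0 < γ ^ 2 + x ^ 2 := by positivity
  have hquad := (((hasDerivAt_id x).const_sub a).pow 2).div_const (2 * μ)
  have hlog := ((((hasDerivAt_id x).pow 2).const_add (γ ^ 2)).div_const γ).log
    (div_pos hpos hγ).ne'
  refine (hquad.add hlog).congr_deriv ?_
  simp only [id, Pi.pow_apply, Nat.cast_ofNat]
  field_simp
  ring

theorem strictMono_cauchyCost_deriv {μ γ : ℝ} (hμ : 0 < μ) (hγ : 0 < γ)
    (hcond : μ ≤ 4 * γ ^ 2) (a : ℝ) :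
    StrictMono fun x : ℝ => (x - a) / μ + 2 * x / (γ ^ 2 + x ^ 2) := by
  intro x y hxy
  have hx : 0 < γ ^ 2 + x ^ 2 := by positivity
  have hy : 0 < γ ^ 2 + y ^ 2 := by positivity
  have hne : 0 < (x - y) ^ 2 := by nlinarith
  have hcurv : 0 < (γ ^ 2 + x ^ 2) * (γ ^ 2 + y ^ 2) + 2 * μ * (γ ^ 2 - x * y) := by
    rcases le_total 0 (γ ^ 2 - x * y) with h | h
    · positivity
    · have hsq : 0 < (x * y - 3 * γ ^ 2) ^ 2 + γ ^ 2 * (x - y) ^ 2 := by positivity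
      nlinarith [mul_le_mul_of_nonpos_right hcond h]
  have hdiff : ((y - a) / μ + 2 * y / (γ ^ 2 + y ^ 2))
      - ((x - a) / μ + 2 * x / (γ ^ 2 + x ^ 2))
      = (y - x) * ((γ ^ 2 + x ^ 2) * (γ ^ 2 + y ^ 2) + 2 * μ * (γ ^ 2 - x * y))
        / (μ * ((γ ^ 2 + x ^ 2) * (γ ^ 2 + y ^ 2))) := by
    field_simp
    ring
  refine sub_pos.mp ?_
  rw [hdiff]
  exact div_pos (mul_pos (sub_pos.mpr hxy) hcurv) (by positivity)

theorem strictConvexOn_cauchyCost {μ γ : ℝ} (hμ : 0 < μ) (hγ : 0 < γ)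
    (hcond : μ ≤ 4 * γ ^ 2) (a : ℝ) :
    StrictConvexOn ℝ univ
      fun x : ℝ => (a - x) ^ 2 / (2 * μ) + Real.log ((γ ^ 2 + x ^ 2) / γ) := by
  refine StrictMono.strictConvexOn_univ_of_deriv
    (continuous_iff_continuousAt.mpr fun x => (hasDerivAt_cauchyCost hμ hγ a x).continuousAt) ?_
  rw [funext fun x => (hasDerivAt_cauchyCost hμ hγ a x).deriv]
  exact strictMono_cauchyCost_deriv hμ hγ hcond a

theorem tendsto_cauchyCost_cocompact {μ γ : ℝ} (hμ : 0 < μ) (hγ : 0 < γ) (a : ℝ) :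
    Tendsto (fun x : ℝ => (a - x) ^ 2 / (2 * μ) + Real.log ((γ ^ 2 + x ^ 2) / γ))
      (cocompact ℝ) atTop := by
  have hquad : Tendsto (fun x : ℝ => (a - x) ^ 2 / (2 * μ)) (cocompact ℝ) atTop := by
    refine Tendsto.atTop_div_const (by positivity) ?_
    refine ((tendsto_pow_atTop two_ne_zero).comp
      (tendsto_dist_left_cocompact_atTop a)).congr fun x => ?_
    simp [Real.dist_eq, sq_abs]
  refine tendsto_atTop_add_right_of_le _ (Real.log γ) hquad fun x => ?_
  refine Real.log_le_log hγ ?_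
  rw [le_div_iff₀ hγ]
  nlinarith [sq_nonneg x]

theorem exists_forall_ne_cauchyCost_lt {μ γ : ℝ} (hμ : 0 < μ) (hγ : 0 < γ)
    (hcond : μ ≤ 4 * γ ^ 2) (a : ℝ) :
    ∃ x : ℝ, ∀ y, y ≠ x → (a - x) ^ 2 / (2 * μ) + Real.log ((γ ^ 2 + x ^ 2) / γ) <
      (a - y) ^ 2 / (2 * μ) + Real.log ((γ ^ 2 + y ^ 2) / γ) := by
  obtain ⟨x, hx⟩ := (continuous_iff_continuousAt.mpr fun x =>
    (hasDerivAt_cauchyCost hμ hγ a x).continuousAt).exists_forall_le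
      (tendsto_cauchyCost_cocompact hμ hγ a)
  refine ⟨x, fun y hyx => lt_of_le_of_ne (hx y) fun heq => hyx ?_⟩
  refine (strictConvexOn_cauchyCost hμ hγ hcond a).eq_of_isMinOn
    (fun z _ => ?_) (fun z _ => hx z) (mem_univ y) (mem_univ x)
  exact heq.symm.le.trans (hx z)

theorem cauchy_fb_subproblem_unique_min (n : ℕ) (μ γ : ℝ) (hμ : 0 < μ) (hγ : 0 < γ)
    (hcond : Real.sqrt μ / 2 ≤ γ) (c : EuclideanSpace ℝ (Fin n)) :
    ∃! ustar : EuclideanSpace ℝ (Fin n),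
      ∀ u : EuclideanSpace ℝ (Fin n),
        ‖c - ustar‖ ^ 2 / (2 * μ) + ∑ i, Real.log ((γ ^ 2 + (ustar i) ^ 2) / γ) ≤
        ‖c - u‖ ^ 2 / (2 * μ) + ∑ i, Real.log ((γ ^ 2 + (u i) ^ 2) / γ) := by
  have hcond' : μ ≤ 4 * γ ^ 2 := by
    nlinarith [Real.sq_sqrt hμ.le, Real.sqrt_nonneg μ]
  have hsep (u : EuclideanSpace ℝ (Fin n)) :
      ‖c - u‖ ^ 2 / (2 * μ) + ∑ i, Real.log ((γ ^ 2 + (u i) ^ 2) / γ) =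
        ∑ i, ((c i - u i) ^ 2 / (2 * μ) + Real.log ((γ ^ 2 + (u i) ^ 2) / γ)) := by
    simp [EuclideanSpace.real_norm_sq_eq, Finset.sum_add_distrib, Finset.sum_div]
  choose x hx using fun i => exists_forall_ne_cauchyCost_lt hμ hγ hcond' (c i)
  have hle (i : Fin n) (y : ℝ) :
      (c i - x i) ^ 2 / (2 * μ) + Real.log ((γ ^ 2 + x i ^ 2) / γ) ≤
        (c i - y) ^ 2 / (2 * μ) + Real.log ((γ ^ 2 + y ^ 2) / γ) := by
    rcases eq_or_ne y (x i) with rfl | h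
    · exact le_rfl
    · exact (hx i y h).le
  simp only [hsep]
  refine ⟨WithLp.toLp 2 x, fun u => Finset.sum_le_sum fun i _ => hle i (u i), fun v hv => ?_⟩
  ext i
  by_contra hne
  exact (hv (WithLp.toLp 2 x)).not_gt
    (Finset.sum_lt_sum (fun j _ => hle j (v j)) ⟨i, Finset.mem_univ i, hx i (v i) hne⟩)
end
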